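/- (F2) In the canonical construction, the R-equivalence class containing the unique maxiconsistent extension w of Σ contains w only, i.e., for every L-maxiconsistent w', if wRw' then w' = w. -/

import Mathlib

set_option maxHeartbeats 1000000

/-! Syntax: countably many variables (indexed by ℕ), Booleans (⊥, →),
    modalities `S` (box), `[c]_a` (cstit) and `I_a` (imag) for agents in `Agent`. -/

inductive Form (Agent : Type) : Type
  | var : ℕ → Form Agent
  | fls : Form Agent
  | imp : Form Agent → Form Agent → Form Agent
  | box : Form Agent → Form Agent
  | cstit : Agent → Form Agent → Form Agent
  | imag : Agent → Form Agent → Form Agent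

namespace Form

variable {Agent : Type}

def neg (A : Form Agent) : Form Agent := A.imp .fls

def conj (A B : Form Agent) : Form Agent := (A.imp B.neg).neg

def fiff (A B : Form Agent) : Form Agent := (A.imp B).conj (B.imp A)

/-- `P`, the dual of `S`. -/
def pos (A : Form Agent) : Form Agent := A.neg.box.neg

/-- The dual of `[c]_a`. -/
def posC (a : Agent) (A : Form Agent) : Form Agent := (Form.cstit a A.neg).neg

def verum : Form Agent := (Form.fls : Form Agent).neg

end Form

def listConj {Agent : Type} : List (Form Agent) → Form Agent
  | [] => Form.verum
  | A :: l => A.conj (listConj l)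

/-- Propositional tautologies: true under every Boolean valuation treating
    variables and modalized formulas as atoms. -/
def Tautology {Agent : Type} (A : Form Agent) : Prop :=
  ∀ v : Form Agent → Prop, ¬ v .fls → (∀ B C : Form Agent, v (B.imp C) ↔ (v B → v C)) → v A

/-- The Hilbert system L: (A0) tautologies, (A1) S is S5, (A2) each [c]_a is S5,
    (A3) SA → [c]_aA, (A4) independence axiom, (A5) imagination-as-action axiom;
    rules: modus ponens, S-necessitation, replacement of equivalents under I_a. -/
inductive Prov {Agent : Type} : Form Agent → Prop
  | taut {A : Form Agent} : Tautology A → Prov A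
  | sK (A B : Form Agent) : Prov ((A.imp B).box.imp (A.box.imp B.box))
  | sT (A : Form Agent) : Prov (A.box.imp A)
  | s5 (A : Form Agent) : Prov (A.pos.imp A.pos.box)
  | cK (a : Agent) (A B : Form Agent) :
      Prov ((Form.cstit a (A.imp B)).imp ((Form.cstit a A).imp (Form.cstit a B)))
  | cT (a : Agent) (A : Form Agent) : Prov ((Form.cstit a A).imp A)
  | c5 (a : Agent) (A : Form Agent) :
      Prov ((Form.posC a A).imp (Form.cstit a (Form.posC a A)))
  | a3 (a : Agent) (A : Form Agent) : Prov (A.box.imp (Form.cstit a A))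
  | a4 (l : List (Agent × Form Agent)) (hne : l ≠ []) (hnd : (l.map Prod.fst).Nodup) :
      Prov ((listConj (l.map fun p => (Form.cstit p.1 p.2).pos)).imp
        (listConj (l.map fun p => Form.cstit p.1 p.2)).pos)
  | a5 (a : Agent) (A : Form Agent) :
      Prov ((Form.imag a A).imp ((Form.cstit a (Form.imag a A)).conj (Form.imag a A).box.neg))
  | mp {A B : Form Agent} : Prov (A.imp B) → Prov A → Prov B
  | necS {A : Form Agent} : Prov A → Prov A.box
  | reI (a : Agent) {A B : Form Agent} :
      Prov (A.fiff B) → Prov ((Form.imag a A).fiff (Form.imag a B))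

/-- A set is L-consistent iff no finite conjunction of its members derives a contradiction. -/
def Consistent {Agent : Type} (Γ : Set (Form Agent)) : Prop :=
  ¬ ∃ l : List (Form Agent), (∀ A ∈ l, A ∈ Γ) ∧ Prov ((listConj l).imp .fls)

/-- L-maxiconsistent: L-consistent and maximal among L-consistent sets. -/
def MaxConsistent {Agent : Type} (w : Set (Form Agent)) : Prop :=
  Consistent w ∧ ∀ Γ : Set (Form Agent), Consistent Γ → w ⊆ Γ → Γ = w

/-- Σ = {¬p : p ∈ Var} ∪ {SA ↔ A} ∪ {[c]_aA ↔ A}. -/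
def SigmaSet (Agent : Type) : Set (Form Agent) :=
  {φ | (∃ n : ℕ, φ = (Form.var n : Form Agent).neg) ∨
       (∃ A : Form Agent, φ = A.box.fiff A) ∨
       (∃ (a : Agent) (A : Form Agent), φ = (Form.cstit a A).fiff A)}

/-! Semantics: imagination models and satisfaction. -/

/-- The raw data of an imagination model (frame conditions separated out below). -/
structure PreModel (Agent : Type) where
  Tree : Type
  le : Tree → Tree → Prop
  Choice : Tree → Agent → Set (Set (Set Tree))
  N : Agent → Tree → Set Tree → Set (Set (Tree × Set Tree))
  V : ℕ → Set (Tree × Set Tree)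

namespace PreModel

variable {Agent : Type} (M : PreModel Agent)

/-- Histories are maximal chains. -/
def IsHist (h : Set M.Tree) : Prop := IsMaxChain M.le h

/-- The set of histories passing through `m`. -/
def Hm (m : M.Tree) : Set (Set M.Tree) := {h | M.IsHist h ∧ m ∈ h}

/-- `Choice^m_a(h)`: the histories lying in the same choice cell as `h` at `m`. -/
def Cell (m : M.Tree) (a : Agent) (h : Set M.Tree) : Set (Set M.Tree) :=
  {h' | ∃ e ∈ M.Choice m a, h ∈ e ∧ h' ∈ e}

/-- Satisfaction at a moment-history pair. -/
def Sat : Form Agent → M.Tree → Set M.Tree → Prop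
  | .var n, m, h => (m, h) ∈ M.V n
  | .fls, _, _ => False
  | .imp A B, m, h => Sat A m h → Sat B m h
  | .box A, m, h => ∀ h' ∈ M.Hm m, Sat A m h'
  | .cstit a A, m, h => ∀ h' ∈ M.Cell m a h, Sat A m h'
  | .imag a A, m, h =>
      (∀ h' ∈ M.Cell m a h,
        {p : M.Tree × Set M.Tree | M.IsHist p.2 ∧ p.1 ∈ p.2 ∧ Sat A p.1 p.2} ∈ M.N a m h') ∧
      (∃ h'' ∈ M.Hm m,
        {p : M.Tree × Set M.Tree | M.IsHist p.2 ∧ p.1 ∈ p.2 ∧ Sat A p.1 p.2} ∉ M.N a m h'')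

end PreModel

/-- An imagination model: the raw data together with all frame conditions. -/
structure IModel (Agent : Type) extends PreModel Agent where
  tree_nonempty : Nonempty Tree
  le_refl : ∀ x, le x x
  le_antisymm : ∀ x y, le x y → le y x → x = y
  le_trans : ∀ x y z, le x y → le y z → le x z
  lower_bound : ∀ m1 m2, ∃ m, le m m1 ∧ le m m2
  past_linear : ∀ m m1 m2, le m1 m → le m2 m → le m1 m2 ∨ le m2 m1
  choice_cells_nonempty : ∀ m a, ∀ e ∈ Choice m a, e.Nonempty
  choice_cover : ∀ m a, ⋃₀ (Choice m a) = toPreModel.Hm m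
  choice_disjoint : ∀ m a, ∀ e ∈ Choice m a, ∀ e' ∈ Choice m a, e ≠ e' → e ∩ e' = ∅
  no_choice_between_undivided : ∀ m a, ∀ e ∈ Choice m a, ∀ h h',
      h ∈ toPreModel.Hm m → h' ∈ toPreModel.Hm m → h ∈ e →
      (∃ m', (le m m' ∧ m ≠ m') ∧ m' ∈ h ∧ m' ∈ h') → h' ∈ e
  independence : ∀ m (f : Agent → Set (Set Tree)), (∀ a, f a ∈ Choice m a) →
      (⋂ a, f a).Nonempty

/-! The canonical model. -/

section Canonical

variable {Agent : Type}

/-- wRw' iff {A : SA ∈ w} ⊆ w'. -/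
def CanR (w w' : Set (Form Agent)) : Prop := ∀ A : Form Agent, A.box ∈ w → A ∈ w'

/-- w ≃_a w' iff {A : [c]_aA ∈ w} ⊆ w'. -/
def CanC (a : Agent) (w w' : Set (Form Agent)) : Prop :=
  ∀ A : Form Agent, Form.cstit a A ∈ w → A ∈ w'

/-- The R-class of a maxiconsistent set. -/
def RCls (w : Set (Form Agent)) : Set (Set (Form Agent)) :=
  {w' | MaxConsistent w' ∧ CanR w w'}

/-- Ξ: the set of R-equivalence classes. -/
def Xi (Agent : Type) : Set (Set (Set (Form Agent))) :=
  {X | ∃ w, MaxConsistent w ∧ X = RCls w}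

/-- E(X,a): the ≃_a-equivalence classes within X. -/
def ECls (X : Set (Set (Form Agent))) (a : Agent) : Set (Set (Set (Form Agent))) :=
  {e | ∃ w ∈ X, e = {w' ∈ X | CanC a w w'}}

/-- Raw canonical points: the fresh root `none`, classes `some (inl X)`, worlds `some (inr w)`. -/
def CPoint (Agent : Type) : Type := Option (Set (Set (Form Agent)) ⊕ Set (Form Agent))

/-- Tree = {0} ∪ Ξ ∪ W. -/
def CTreeSet (Agent : Type) : Set (CPoint Agent) :=
  {x | x = none ∨ (∃ X ∈ Xi Agent, x = some (Sum.inl X)) ∨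
       (∃ w, MaxConsistent w ∧ x = some (Sum.inr w))}

def CTree (Agent : Type) : Type := {x : CPoint Agent // x ∈ CTreeSet Agent}

/-- x ≤ y iff x = y or y ∈ x or x = 0. -/
def CLe (x y : CTree Agent) : Prop :=
  x = y ∨ (∃ X w, x.1 = some (Sum.inl X) ∧ y.1 = some (Sum.inr w) ∧ w ∈ X) ∨ x.1 = none

/-- h_w = {0, X, w}. -/
def CHistX (X : Set (Set (Form Agent))) (w : Set (Form Agent)) : Set (CTree Agent) :=
  {x | x.1 = none ∨ x.1 = some (Sum.inl X) ∨ x.1 = some (Sum.inr w)}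

def IsClsMoment (m : CTree Agent) : Prop := ∃ X, m.1 = some (Sum.inl X)

/-- The canonical choice function: vacuous outside Ξ, induced by E(X,a) at X ∈ Ξ. -/
def CChoice (m : CTree Agent) (a : Agent) : Set (Set (Set (CTree Agent))) :=
  {H | (¬ IsClsMoment m ∧ H = {h | IsMaxChain CLe h ∧ m ∈ h}) ∨
       (∃ X, m.1 = some (Sum.inl X) ∧ ∃ e ∈ ECls X a,
          H = {h | ∃ w ∈ e, h = CHistX X w})}

/-- Ext(A): {X/h_w : w ∈ X ∈ Ξ, A ∈ w}, augmented by all pairs m/h_w with m ∉ Ξ, m ∈ h_w,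
    in case A belongs to the maxiconsistent extension of Σ. -/
def CExt (A : Form Agent) : Set (CTree Agent × Set (CTree Agent)) :=
  {p | ∃ X w, X ∈ Xi Agent ∧ w ∈ X ∧ A ∈ w ∧
        p.1.1 = some (Sum.inl X) ∧ p.2 = CHistX X w} ∪
  {p | (∃ w0, MaxConsistent w0 ∧ SigmaSet Agent ⊆ w0 ∧ A ∈ w0) ∧
        ∃ X w, X ∈ Xi Agent ∧ w ∈ X ∧ p.2 = CHistX X w ∧
          ¬ IsClsMoment p.1 ∧ p.1 ∈ p.2}

/-- N_a(X/h_w) = {Ext A : I_aA ∈ w}; empty at moments outside Ξ. -/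
def CN (a : Agent) (m : CTree Agent) (h : Set (CTree Agent)) :
    Set (Set (CTree Agent × Set (CTree Agent))) :=
  {P | ∃ X w, m.1 = some (Sum.inl X) ∧ X ∈ Xi Agent ∧ w ∈ X ∧ h = CHistX X w ∧
        ∃ A, Form.imag a A ∈ w ∧ P = CExt A}

/-- V(p) = {X/h_w : w ∈ X ∈ Ξ, p ∈ w}. -/
def CV (Agent : Type) (n : ℕ) : Set (CTree Agent × Set (CTree Agent)) :=
  {p | ∃ X w, X ∈ Xi Agent ∧ w ∈ X ∧ Form.var n ∈ w ∧
        p.1.1 = some (Sum.inl X) ∧ p.2 = CHistX X w}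

/-- The canonical model (raw data). -/
def CanModel (Agent : Type) : PreModel Agent where
  Tree := CTree Agent
  le := CLe
  Choice := CChoice
  N := CN
  V := CV Agent

/-- The canonical moment corresponding to a class X ∈ Ξ. -/
def clsMoment {X : Set (Set (Form Agent))} (hX : X ∈ Xi Agent) : CTree Agent :=
  ⟨some (Sum.inl X), Or.inr (Or.inl ⟨X, hX, rfl⟩)⟩

end Canonical

theorem val_conj {Agent : Type} (v : Form Agent → Prop) (h0 : ¬ v .fls)
    (h1 : ∀ B C : Form Agent, v (B.imp C) ↔ (v B → v C)) (A B : Form Agent) :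
    v (A.conj B) ↔ v A ∧ v B := by
  simp only [Form.conj, Form.neg, h1]
  tauto

theorem val_listConj {Agent : Type} (v : Form Agent → Prop) (h0 : ¬ v .fls)
    (h1 : ∀ B C : Form Agent, v (B.imp C) ↔ (v B → v C)) (l : List (Form Agent)) :
    v (listConj l) ↔ ∀ A ∈ l, v A := by
  induction l with
  | nil => simp [listConj, Form.verum, Form.neg, h1]
  | cons A l ih => simp [listConj, val_conj v h0 h1, ih]

/-- F2: the R-class of the unique maxiconsistent extension w of Σ
    contains w only: if w' is maxiconsistent and wRw' then w' = w. -/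
theorem sigma_class_singleton (Agent : Type) [Fintype Agent]
    (w w' : Set (Form Agent)) (hw : MaxConsistent w) (hSig : SigmaSet Agent ⊆ w)
    (hw' : MaxConsistent w') (hR : CanR w w') : w' = w := by
  classical
  refine hw.2 w' hw'.1 fun A hA => hR A ?_
  have hE : A.box.fiff A ∈ w := hSig (Or.inr (Or.inl ⟨A, rfl⟩))
  have hc : Consistent (insert A.box w) := by
    rintro ⟨l, hl, hp⟩
    refine hw.1 ⟨A.box.fiff A :: A :: l.filter (fun B => decide (B ≠ A.box)), ?_, ?_⟩
    · intro B hB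
      simp only [List.mem_cons, List.mem_filter, decide_eq_true_eq] at hB
      rcases hB with rfl | rfl | ⟨h, hne⟩
      · exact hE
      · exact hA
      · exact (hl B h).resolve_left hne
    · refine Prov.mp (Prov.taut ?_) hp
      intro v h0 h1
      simp only [h1, val_listConj v h0 h1]
      intro hf hall
      refine absurd (hf fun B hB => ?_) h0
      have h2 := hall (A.box.fiff A) (by simp)
      have h3 := hall A (by simp)
      rw [Form.fiff, val_conj v h0 h1, h1, h1] at h2
      by_cases hBA : B = A.box
      · rw [hBA]; exact h2.2 h3
      · exact hall B (by simp [hB, hBA])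
  rw [← hw.2 _ hc (Set.subset_insert _ _)]
  exact Set.mem_insert _ _
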